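/- Let R be an associative unital ℝ-algebra, I ⊆ R a two-sided ideal, and τ : I → ℝ a linear functional satisfying τ(x*y) = τ(y*x) whenever x ∈ I and y ∈ R (note that both products then lie in I). Let ε ∈ R satisfy ε² = 1, and let S = {a ∈ R : ε*a - a*ε ∈ I}, which is a Lie subalgebra of R under the commutator bracket. Then the formula c(a,b) = ½ τ(ε*⁅ε,a⁆*⁅ε,b⁆) is well defined on S × S (the argument ε*⁅ε,a⁆*⁅ε,b⁆ lies in I), c is bilinear and alternating (c(b,a) = -c(a,b)), and c satisfies the Lie algebra 2-cocycle identity c(⁅a,b⁆,x) + c(⁅b,x⁆,a) + c(⁅x,a⁆,b) = 0 for all a, b, x ∈ S. -/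

import Mathlib

section SignOperator

variable {R : Type*} [Ring R]

theorem mul_lie_eq_neg_lie_mul_of_sq_eq_one {ε : R} (hε : ε * ε = 1) (a : R) :
    ε * ⁅ε, a⁆ = -(⁅ε, a⁆ * ε) := by
  have h₁ : ε * (ε * a) = a := by rw [← mul_assoc, hε, one_mul]
  have h₂ : a * ε * ε = a := by rw [mul_assoc, hε, mul_one]
  rw [Ring.lie_def, mul_sub, sub_mul, h₁, h₂, mul_assoc]
  abel

variable [Algebra ℝ R] {I : Submodule ℝ R} {T : R →ₗ[ℝ] ℝ} {ε : R}

/-- A trace vanishes on the elements of the ideal that anticommute with the sign operator. -/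
theorem trace_eq_zero_of_anticommute (hleft : ∀ r x : R, x ∈ I → r * x ∈ I)
    (hT : ∀ x y : R, x ∈ I → T (x * y) = T (y * x)) (hε : ε * ε = 1)
    {y : R} (hy : y ∈ I) (hεy : ε * y = -(y * ε)) : T y = 0 := by
  have h₁ : T (ε * y * ε) = T y := by
    rw [hT _ _ (hleft ε y hy), ← mul_assoc, hε, one_mul]
  have h₂ : T (ε * y * ε) = -T y := by
    rw [hεy, neg_mul, mul_assoc, hε, mul_one, map_neg]
  linarith

theorem trace_mul_lie_mul_lie_cyclic (hleft : ∀ r x : R, x ∈ I → r * x ∈ I)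
    (hT : ∀ x y : R, x ∈ I → T (x * y) = T (y * x)) (hε : ε * ε = 1)
    (a u : R) {v : R} (hv : ⁅ε, v⁆ ∈ I) :
    T (ε * a * ⁅ε, u⁆ * ⁅ε, v⁆) = -T (ε * ⁅ε, v⁆ * a * ⁅ε, u⁆) := by
  have hD := mul_lie_eq_neg_lie_mul_of_sq_eq_one hε a
  have hE := mul_lie_eq_neg_lie_mul_of_sq_eq_one hε u
  have hF := mul_lie_eq_neg_lie_mul_of_sq_eq_one hε v
  have h₀ : T (⁅ε, a⁆ * ⁅ε, u⁆ * ⁅ε, v⁆) = 0 := by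
    refine trace_eq_zero_of_anticommute hleft hT hε (hleft _ _ hv) ?_
    rw [← mul_assoc, ← mul_assoc, hD, neg_mul, mul_assoc _ ε, hE, mul_neg, neg_neg, ← mul_assoc,
      mul_assoc _ ε, hF, mul_neg, ← mul_assoc]
  have h₁ : T (ε * ⁅ε, v⁆ * a * ⁅ε, u⁆) = -T (a * ε * ⁅ε, u⁆ * ⁅ε, v⁆) := by
    rw [mul_assoc _ a, hT _ _ (hleft _ _ hv), ← mul_assoc, mul_assoc a, mul_assoc a ε, hE]
    simp only [mul_neg, neg_mul, map_neg, neg_neg]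
  rw [h₁, neg_neg, ← sub_eq_zero, ← map_sub, ← sub_mul, ← sub_mul]
  exact h₀

end SignOperator

/-- Algebraic core of: `c(A,B) = ½ tr(ε[ε,A][ε,B])` is a well-defined `ℝ`-valued Lie algebra
2-cocycle on the Lie algebra `S = {a : [ε,a] ∈ I}` (the Schwinger cocycle).  Here `R` is the
algebra of operators, `I` a two-sided ideal (the smoothing operators) carried as a submodule,
`τ` a tracial linear functional on `I` (the operator trace), and `ε` a sign operator,
`ε² = 1`.  The bracket `⁅·,·⁆` is the ring commutator. -/
theorem stmt3 {R : Type*} [Ring R] [Algebra ℝ R] (I : Submodule ℝ R)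
    (hleft : ∀ r x : R, x ∈ I → r * x ∈ I)
    (hright : ∀ x r : R, x ∈ I → x * r ∈ I)
    (τ : I →ₗ[ℝ] ℝ)
    (hτ : ∀ (x y : R) (hx : x ∈ I), τ ⟨x * y, hright x y hx⟩ = τ ⟨y * x, hleft y x hx⟩)
    (ε : R) (hε : ε * ε = 1)
    (S : Set R) (hS : S = {a : R | ε * a - a * ε ∈ I})
    (τ' : R → ℝ) (hτ' : ∀ (x : R) (hx : x ∈ I), τ' x = τ ⟨x, hx⟩)
    (c : R → R → ℝ) (hc : ∀ a b : R, c a b = (1 / 2) * τ' (ε * ⁅ε, a⁆ * ⁅ε, b⁆)) :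
    -- well-definedness: the argument of the trace lies in the ideal `I`
    (∀ a ∈ S, ∀ b ∈ S, ε * ⁅ε, a⁆ * ⁅ε, b⁆ ∈ I) ∧
    -- `S` is a Lie subalgebra of `R` under the commutator bracket
    (∀ a ∈ S, ∀ b ∈ S, ⁅a, b⁆ ∈ S) ∧
    (∀ (r : ℝ) (a : R), a ∈ S → r • a ∈ S) ∧
    (∀ a ∈ S, ∀ b ∈ S, a + b ∈ S) ∧
    -- `c` is bilinear on `S`
    (∀ a ∈ S, ∀ a' ∈ S, ∀ b ∈ S, c (a + a') b = c a b + c a' b) ∧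
    (∀ (r : ℝ), ∀ a ∈ S, ∀ b ∈ S, c (r • a) b = r * c a b) ∧
    (∀ a ∈ S, ∀ b ∈ S, ∀ b' ∈ S, c a (b + b') = c a b + c a b') ∧
    (∀ (r : ℝ), ∀ a ∈ S, ∀ b ∈ S, c a (r • b) = r * c a b) ∧
    -- `c` is alternating
    (∀ a ∈ S, ∀ b ∈ S, c b a = - c a b) ∧
    -- `c` satisfies the Lie algebra 2-cocycle identity
    (∀ a ∈ S, ∀ b ∈ S, ∀ x ∈ S, c ⁅a, b⁆ x + c ⁅b, x⁆ a + c ⁅x, a⁆ b = 0) := by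
  obtain ⟨T, hTτ⟩ := τ.exists_extend
  have hTI (x : R) (hx : x ∈ I) : T x = τ ⟨x, hx⟩ := LinearMap.congr_fun hTτ ⟨x, hx⟩
  have hT (x y : R) (hx : x ∈ I) : T (x * y) = T (y * x) := by
    rw [hTI _ (hright x y hx), hTI _ (hleft y x hx), hτ x y hx]
  have hmem (a : R) : a ∈ S ↔ ⁅ε, a⁆ ∈ I := by rw [hS]; rfl
  have hI (a b : R) (hb : b ∈ S) : ε * ⁅ε, a⁆ * ⁅ε, b⁆ ∈ I := hleft _ _ ((hmem b).1 hb)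
  have hcT (a b : R) (hb : b ∈ S) : c a b = 1 / 2 * T (ε * ⁅ε, a⁆ * ⁅ε, b⁆) := by
    rw [hc, hτ' _ (hI a b hb), hTI]
  have hadd_lie (a b : R) : ⁅ε, a + b⁆ = ⁅ε, a⁆ + ⁅ε, b⁆ := by
    simp only [Ring.lie_def]
    noncomm_ring
  have hsmul_lie (r : ℝ) (a : R) : ⁅ε, r • a⁆ = r • ⁅ε, a⁆ := by
    simp only [Ring.lie_def, mul_smul_comm, smul_mul_assoc, smul_sub]
  have hlie (a b : R) : ⁅ε, ⁅a, b⁆⁆ = ⁅ε, a⁆ * b - b * ⁅ε, a⁆ + (a * ⁅ε, b⁆ - ⁅ε, b⁆ * a) := by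
    simp only [Ring.lie_def]
    noncomm_ring
  have hadd (a : R) (ha : a ∈ S) (b : R) (hb : b ∈ S) : a + b ∈ S := by
    rw [hmem] at *
    rw [hadd_lie]
    exact I.add_mem ha hb
  have hsmul (r : ℝ) (a : R) (ha : a ∈ S) : r • a ∈ S := by
    rw [hmem] at *
    rw [hsmul_lie]
    exact I.smul_mem r ha
  refine ⟨fun a _ b hb => hI a b hb, ?_, hsmul, hadd, ?_, ?_, ?_, ?_, ?_, ?_⟩
  · intro a ha b hb
    rw [hmem] at *
    rw [hlie]
    exact I.add_mem (I.sub_mem (hright _ _ ha) (hleft _ _ ha))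
      (I.sub_mem (hleft _ _ hb) (hright _ _ hb))
  · intro a _ a' _ b hb
    rw [hcT _ _ hb, hcT _ _ hb, hcT _ _ hb, hadd_lie, mul_add, add_mul, map_add, mul_add]
  · intro r a _ b hb
    rw [hcT _ _ hb, hcT _ _ hb, hsmul_lie, mul_smul_comm, smul_mul_assoc, map_smul, smul_eq_mul,
      mul_left_comm]
  · intro a _ b hb b' hb'
    rw [hcT _ _ (hadd b hb b' hb'), hcT _ _ hb, hcT _ _ hb', hadd_lie, mul_add, map_add, mul_add]
  · intro r a _ b hb
    rw [hcT _ _ (hsmul r b hb), hcT _ _ hb, hsmul_lie, mul_smul_comm, map_smul, smul_eq_mul,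
      mul_left_comm]
  · intro a ha b hb
    rw [hcT _ _ ha, hcT _ _ hb, hT _ _ (hleft _ _ ((hmem b).1 hb)), ← mul_assoc,
      mul_lie_eq_neg_lie_mul_of_sq_eq_one hε a, neg_mul, map_neg, mul_neg, neg_neg]
  · intro a ha b hb x hx
    have hexpand (a b x : R) : T (ε * ⁅ε, ⁅a, b⁆⁆ * ⁅ε, x⁆) =
        T (ε * ⁅ε, a⁆ * b * ⁅ε, x⁆) - T (ε * b * ⁅ε, a⁆ * ⁅ε, x⁆) +
          (T (ε * a * ⁅ε, b⁆ * ⁅ε, x⁆) - T (ε * ⁅ε, b⁆ * a * ⁅ε, x⁆)) := by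
      simp only [hlie, mul_add, mul_sub, add_mul, sub_mul, map_add, map_sub, mul_assoc]
    have hcyc (a u v : R) (hv : v ∈ S) :=
      trace_mul_lie_mul_lie_cyclic hleft hT hε a u ((hmem v).1 hv)
    rw [hcT _ _ hx, hcT _ _ ha, hcT _ _ hb, hexpand, hexpand, hexpand]
    linarith [hcyc a b x hx, hcyc a x b hb, hcyc b a x hx, hcyc b x a ha, hcyc x a b hb,
      hcyc x b a ha]
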